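/- In any routing game in which every edge cost c_e is C¹, nonnegative, nondecreasing, with t ↦ t·c_e(t) convex on [0,∞), and such that V*(μ) > 0 for all μ > 0, the price of anarchy PoA is continuous on (0,∞), and PoA is differentiable at every μ > 0 at which the equilibrium cost function λ is differentiable. -/

import Mathlib

open Finset Set

noncomputable section

variable {E P : Type*}

/-- The load induced on edge `e` by a path-flow `f`. -/
def edgeLoad [Fintype P] [DecidableEq E] (path : P → Finset E) (f : P → ℝ) (e : E) : ℝ :=
  ∑ p, if e ∈ path p then f p else 0

/-- A flow is feasible for demand `μ` if it is nonnegative and routes total demand `μ`. -/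
def Feasible [Fintype P] (f : P → ℝ) (μ : ℝ) : Prop :=
  (∀ p, 0 ≤ f p) ∧ ∑ p, f p = μ

/-- The cost of path `p` under flow `f`. -/
def pathCost [Fintype P] [DecidableEq E] (path : P → Finset E) (c : E → ℝ → ℝ)
    (f : P → ℝ) (p : P) : ℝ :=
  ∑ e ∈ path p, c e (edgeLoad path f e)

/-- Wardrop equilibrium with equilibrium cost `lam` at demand `μ`. -/
def IsWardrop [Fintype P] [DecidableEq E] (path : P → Finset E) (c : E → ℝ → ℝ)
    (μ : ℝ) (f : P → ℝ) (lam : ℝ) : Prop :=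
  Feasible f μ ∧ (∀ p, 0 < f p → pathCost path c f p = lam) ∧
    ∀ p, lam ≤ pathCost path c f p

/-- Social cost of a flow. -/
def socialCost [Fintype E] [Fintype P] [DecidableEq E] (path : P → Finset E)
    (c : E → ℝ → ℝ) (f : P → ℝ) : ℝ :=
  ∑ e, edgeLoad path f e * c e (edgeLoad path f e)

/-- The active network: edges lying on some path of cost `lam` (the minimal cost). -/
def activeNet [Fintype P] [DecidableEq E] (path : P → Finset E) (c : E → ℝ → ℝ)
    (f : P → ℝ) (lam : ℝ) : Set E :=
  {e | ∃ p, pathCost path c f p = lam ∧ e ∈ path p}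

/-- `μ₀` is a breakpoint of the active-network map `Act`. -/
def IsBreakpoint (Act : ℝ → Set E) (μ₀ : ℝ) : Prop :=
  0 < μ₀ ∧ ∃ ε > 0,
    (∀ μ ∈ Set.Ico (μ₀ - ε) μ₀, Act μ = Act (μ₀ - ε)) ∧
    (∀ μ ∈ Set.Ioc μ₀ (μ₀ + ε), Act μ = Act (μ₀ + ε)) ∧
    Act (μ₀ - ε) ≠ Act (μ₀ + ε)

open Filter Topology in
/-- A function squeezed between two functions that touch at `x` with equal derivatives is
differentiable there with the same derivative. -/
lemma HasDerivAt.squeeze {l g u : ℝ → ℝ} {d x : ℝ} (hl : HasDerivAt l d x) (hu : HasDerivAt u d x)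
    (hlx : l x = g x) (hux : u x = g x) (hlg : ∀ᶠ y in 𝓝 x, l y ≤ g y)
    (hgu : ∀ᶠ y in 𝓝 x, g y ≤ u y) : HasDerivAt g d x := by
  rw [hasDerivAt_iff_isLittleO, Asymptotics.isLittleO_iff] at *
  intro ε hε
  filter_upwards [hl hε, hu hε, hlg, hgu] with y h₁ h₂ h₃ h₄
  rw [Real.norm_eq_abs, abs_le] at *
  rw [hlx] at h₁
  rw [hux] at h₂
  constructor <;> linarith [h₁.1, h₂.2]

open Filter Topology in
/-- A selection of subgradients is upper semicontinuous where it is the derivative. -/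
lemma eventually_subgradient_lt {W s : ℝ → ℝ} {x : ℝ} (hx : 0 < x)
    (hsub : ∀ y z, 0 < y → 0 < z → s y * (z - y) ≤ W z - W y)
    (hW : HasDerivAt W (s x) x) {a : ℝ} (ha : s x < a) : ∀ᶠ y in 𝓝 x, s y < a := by
  obtain ⟨z, hz, hxz⟩ :=
    (((hasDerivAt_iff_tendsto_slope.1 hW).mono_left
      (nhdsWithin_mono x fun y (hy : y ∈ Set.Ioi x) => ne_of_gt hy)).eventually (gt_mem_nhds ha)
      |>.and (self_mem_nhdsWithin : Set.Ioi x ∈ 𝓝[>] x)).exists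
  rw [slope_def_field, div_lt_iff₀ (sub_pos.2 hxz)] at hz
  have hcont : ContinuousAt (fun y => W z - W y - a * (z - y)) x :=
    (continuousAt_const.sub hW.continuousAt).sub (by fun_prop)
  filter_upwards [hcont.eventually (gt_mem_nhds (sub_neg.2 hz)), lt_mem_nhds hx, gt_mem_nhds hxz]
    with y h₁ h₂ h₃
  have h := hsub y z h₂ (hx.trans hxz)
  exact lt_of_mul_lt_mul_right (by linarith) (sub_pos.2 h₃).le

open Filter Topology in
/-- A selection of subgradients is lower semicontinuous where it is the derivative. -/
lemma eventually_lt_subgradient {W s : ℝ → ℝ} {x : ℝ} (hx : 0 < x)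
    (hsub : ∀ y z, 0 < y → 0 < z → s y * (z - y) ≤ W z - W y)
    (hW : HasDerivAt W (s x) x) {a : ℝ} (ha : a < s x) : ∀ᶠ y in 𝓝 x, a < s y := by
  obtain ⟨z, ⟨hz, hzx⟩, hz0⟩ :=
    (((hasDerivAt_iff_tendsto_slope.1 hW).mono_left
      (nhdsWithin_mono x fun y (hy : y ∈ Set.Iio x) => ne_of_lt hy)).eventually (lt_mem_nhds ha)
      |>.and (self_mem_nhdsWithin : Set.Iio x ∈ 𝓝[<] x)
      |>.and (nhdsWithin_le_nhds (lt_mem_nhds hx))).exists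
  rw [slope_comm, slope_def_field, lt_div_iff₀ (sub_pos.2 hzx)] at hz
  have hcont : ContinuousAt (fun y => W y - W z - a * (y - z)) x :=
    (hW.continuousAt.sub continuousAt_const).sub (by fun_prop)
  filter_upwards [hcont.eventually (lt_mem_nhds (sub_pos.2 hz)), lt_mem_nhds hx, lt_mem_nhds hzx]
    with y h₁ h₂ h₃
  have h := hsub y z h₂ hz0
  exact lt_of_mul_lt_mul_right (by linarith) (sub_pos.2 h₃).le

/-- Tangent-line inequality for the primitive of a nondecreasing function. -/
lemma Monotone.mul_sub_le_intervalIntegral {c : ℝ → ℝ} (hc : Monotone c) (a b : ℝ) :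
    c a * (b - a) ≤ ∫ t in a..b, c t := by
  rcases le_total a b with hab | hab
  · have h := intervalIntegral.integral_mono_on (μ := MeasureTheory.volume) hab
      (intervalIntegrable_const (c := c a)) hc.intervalIntegrable fun t ht => hc ht.1
    rw [intervalIntegral.integral_const, smul_eq_mul] at h
    linarith
  · have h := intervalIntegral.integral_mono_on (μ := MeasureTheory.volume) hab
      hc.intervalIntegrable (intervalIntegrable_const (c := c a)) fun t ht => hc ht.2
    rw [intervalIntegral.integral_const, smul_eq_mul] at h
    rw [intervalIntegral.integral_symm]
    linarith

section Flows

variable [Fintype P] [DecidableEq E] {path : P → Finset E} {c : E → ℝ → ℝ}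

lemma edgeLoad_smul (r : ℝ) (f : P → ℝ) (e : E) :
    edgeLoad path (r • f) e = r * edgeLoad path f e := by
  simp [edgeLoad, Finset.mul_sum]

lemma edgeLoad_add (f g : P → ℝ) (e : E) :
    edgeLoad path (f + g) e = edgeLoad path f e + edgeLoad path g e := by
  simp only [edgeLoad, ← Finset.sum_add_distrib]
  exact Finset.sum_congr rfl fun p _ => by split_ifs <;> simp

lemma edgeLoad_nonneg {f : P → ℝ} (hf : ∀ p, 0 ≤ f p) (e : E) : 0 ≤ edgeLoad path f e :=
  Finset.sum_nonneg fun p _ => by split_ifs <;> simp [hf p]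

lemma Feasible.smul {f : P → ℝ} {μ r : ℝ} (hf : Feasible f μ) (hr : 0 ≤ r) :
    Feasible (r • f) (r * μ) :=
  ⟨fun p => mul_nonneg hr (hf.1 p), by simp [← Finset.mul_sum, hf.2]⟩

lemma Feasible.add {f g : P → ℝ} {μ ν : ℝ} (hf : Feasible f μ) (hg : Feasible g ν) :
    Feasible (f + g) (μ + ν) :=
  ⟨fun p => add_nonneg (hf.1 p) (hg.1 p), by simp [Finset.sum_add_distrib, hf.2, hg.2]⟩

lemma Feasible.rescale {f : P → ℝ} {μ ν : ℝ} (hf : Feasible f μ) (hμ : 0 < μ) (hν : 0 ≤ ν) :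
    Feasible ((ν / μ) • f) ν := by
  simpa [div_mul_cancel₀ _ hμ.ne'] using hf.smul (div_nonneg hν hμ.le)

lemma IsWardrop.sum_mul_pathCost {f : P → ℝ} {μ lam : ℝ} (h : IsWardrop path c μ f lam) :
    ∑ p, f p * pathCost path c f p = lam * μ := by
  rw [← h.1.2, Finset.mul_sum]
  refine Finset.sum_congr rfl fun p _ => ?_
  rcases (h.1.1 p).eq_or_lt with hp | hp
  · simp [← hp]
  · rw [h.2.1 p hp, mul_comm]

variable [Fintype E]

lemma sum_edgeLoad_mul (f : P → ℝ) (d : E → ℝ) :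
    ∑ e, edgeLoad path f e * d e = ∑ p, f p * ∑ e ∈ path p, d e := by
  simp only [edgeLoad, Finset.sum_mul, Finset.mul_sum]
  rw [Finset.sum_comm]
  refine Finset.sum_congr rfl fun p _ => ?_
  simp [ite_mul, Finset.sum_ite_mem]

variable (path c) in
/-- The Beckmann potential, whose minimizers are the Wardrop equilibria. -/
def beckmann (f : P → ℝ) : ℝ := ∑ e, ∫ t in (0 : ℝ)..edgeLoad path f e, c e t

lemma IsWardrop.mul_sub_le_beckmann (hc_mono : ∀ e, Monotone (c e)) {f g : P → ℝ} {μ ν lam : ℝ}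
    (hf : IsWardrop path c μ f lam) (hg : Feasible g ν) :
    lam * (ν - μ) ≤ beckmann path c g - beckmann path c f := by
  have hcost : lam * ν ≤ ∑ p, g p * pathCost path c f p := by
    rw [← hg.2, Finset.mul_sum]
    refine Finset.sum_le_sum fun p _ => ?_
    rw [mul_comm]
    exact mul_le_mul_of_nonneg_left (hf.2.2 p) (hg.1 p)
  have htangent : ∑ e, c e (edgeLoad path f e) * (edgeLoad path g e - edgeLoad path f e) ≤
      beckmann path c g - beckmann path c f := by
    rw [beckmann, beckmann, ← Finset.sum_sub_distrib]
    refine Finset.sum_le_sum fun e _ => ?_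
    rw [intervalIntegral.integral_interval_sub_left (hc_mono e).intervalIntegrable
      (hc_mono e).intervalIntegrable]
    exact (hc_mono e).mul_sub_le_intervalIntegral _ _
  have hlin : ∑ e, c e (edgeLoad path f e) * (edgeLoad path g e - edgeLoad path f e) =
      ∑ p, g p * pathCost path c f p - ∑ p, f p * pathCost path c f p := by
    simp only [pathCost, ← sum_edgeLoad_mul, ← Finset.sum_sub_distrib]
    exact Finset.sum_congr rfl fun e _ => by ring
  rw [hlin, hf.sum_mul_pathCost] at htangent
  linarith

lemma IsWardrop.hasDerivAt_beckmann_rescale (hc : ∀ e, Continuous (c e)) {f : P → ℝ} {μ lam : ℝ}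
    (hμ : 0 < μ) (hf : IsWardrop path c μ f lam) :
    HasDerivAt (fun ν => beckmann path c ((ν / μ) • f)) lam μ := by
  have hsum : lam = ∑ e, c e (edgeLoad path f e) * (1 / μ * edgeLoad path f e) := by
    have h := sum_edgeLoad_mul (path := path) f fun e => c e (edgeLoad path f e)
    have h' := hf.sum_mul_pathCost
    unfold pathCost at h'
    rw [h'] at h
    rw [eq_comm, ← mul_div_cancel_right₀ lam hμ.ne', ← h, Finset.sum_div]
    exact Finset.sum_congr rfl fun e _ => by ring
  simp only [beckmann, edgeLoad_smul]
  rw [hsum]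
  refine HasDerivAt.fun_sum fun e _ => ?_
  have hload : HasDerivAt (fun ν => ν / μ * edgeLoad path f e) (1 / μ * edgeLoad path f e) μ :=
    ((hasDerivAt_id μ).div_const μ).mul_const _
  have hint : HasDerivAt (fun x => ∫ t in (0 : ℝ)..x, c e t) (c e (edgeLoad path f e))
      (μ / μ * edgeLoad path f e) := by
    rw [div_self hμ.ne', one_mul]
    exact intervalIntegral.integral_hasDerivAt_right ((hc e).intervalIntegrable _ _)
      (hc e).stronglyMeasurable.stronglyMeasurableAtFilter (hc e).continuousAt
  exact hint.comp μ hload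

/-- The equilibrium cost is a continuous function of the demand. -/
lemma continuousAt_equilibriumCost (hc : ∀ e, Continuous (c e)) (hc_mono : ∀ e, Monotone (c e))
    {feq : ℝ → P → ℝ} {lamf : ℝ → ℝ}
    (hfeq : ∀ μ : ℝ, 0 < μ → IsWardrop path c μ (feq μ) (lamf μ)) {μ : ℝ} (hμ : 0 < μ) :
    ContinuousAt lamf μ := by
  have hsub : ∀ y z, 0 < y → 0 < z →
      lamf y * (z - y) ≤ beckmann path c (feq z) - beckmann path c (feq y) := fun y z hy hz =>
    (hfeq y hy).mul_sub_le_beckmann hc_mono (hfeq z hz).1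
  have hlin : HasDerivAt (fun ν => beckmann path c (feq μ) + lamf μ * (ν - μ)) (lamf μ) μ := by
    simpa using (((hasDerivAt_id μ).sub_const μ).const_mul (lamf μ)).const_add
      (beckmann path c (feq μ))
  have hderiv : HasDerivAt (fun ν => beckmann path c (feq ν)) (lamf μ) μ := by
    refine hlin.squeeze ((hfeq μ hμ).hasDerivAt_beckmann_rescale hc hμ) (by simp)
      (by simp [div_self hμ.ne']) ?_ ?_
    · filter_upwards [lt_mem_nhds hμ] with ν hν
      linarith [hsub μ ν hμ hν]
    · filter_upwards [lt_mem_nhds hμ] with ν hν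
      have h := (hfeq ν hν).mul_sub_le_beckmann hc_mono ((hfeq μ hμ).1.rescale hμ hν.le)
      rw [sub_self, mul_zero] at h
      linarith
  exact tendsto_order.2 ⟨fun a ha => eventually_lt_subgradient hμ hsub hderiv ha,
    fun a ha => eventually_subgradient_lt hμ hsub hderiv ha⟩

lemma socialCost_midpoint_le (hc_conv : ∀ e, ConvexOn ℝ (Set.Ici 0) (fun t => t * c e t))
    {f g : P → ℝ} (hf : ∀ p, 0 ≤ f p) (hg : ∀ p, 0 ≤ g p) :
    socialCost path c ((1 / 2 : ℝ) • f + (1 / 2 : ℝ) • g) ≤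
      1 / 2 * socialCost path c f + 1 / 2 * socialCost path c g := by
  simp only [socialCost, Finset.mul_sum, ← Finset.sum_add_distrib]
  refine Finset.sum_le_sum fun e _ => ?_
  rw [edgeLoad_add, edgeLoad_smul, edgeLoad_smul]
  exact (hc_conv e).2 (edgeLoad_nonneg hf e) (edgeLoad_nonneg hg e) (by norm_num) (by norm_num)
    (by norm_num)

/-- The optimal social cost is a differentiable function of the demand. -/
lemma differentiableAt_optimalCost (hc : ∀ e, Differentiable ℝ (c e))
    (hc_conv : ∀ e, ConvexOn ℝ (Set.Ici 0) (fun t => t * c e t)) {Vstar : ℝ → ℝ}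
    (hVstar : ∀ μ : ℝ, 0 ≤ μ →
      IsLeast {y | ∃ f, Feasible f μ ∧ y = socialCost path c f} (Vstar μ))
    {μ : ℝ} (hμ : 0 < μ) : DifferentiableAt ℝ Vstar μ := by
  obtain ⟨f, hf, hVf⟩ := (hVstar μ hμ.le).1
  set U : ℝ → ℝ := fun ν => socialCost path c ((ν / μ) • f) with hU
  have hUμ : U μ = Vstar μ := by simp [hU, div_self hμ.ne', hVf]
  have hVU : ∀ ν, 0 ≤ ν → Vstar ν ≤ U ν := fun ν hν =>
    (hVstar ν hν).2 ⟨_, hf.rescale hμ hν, rfl⟩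
  have hUdiff : Differentiable ℝ U := by
    simp only [hU, socialCost, edgeLoad_smul]
    fun_prop
  have hUd : HasDerivAt U (deriv U μ) μ := (hUdiff μ).hasDerivAt
  have hL : HasDerivAt (fun ν => 2 * Vstar μ - U (2 * μ - ν)) (deriv U μ) μ := by
    have hU' : HasDerivAt U (deriv U μ) (2 * μ - μ) := by
      rwa [show 2 * μ - μ = μ by ring]
    have h := (hU'.comp_const_sub (2 * μ) μ).const_sub (2 * Vstar μ)
    rwa [neg_neg] at h
  refine (hL.squeeze hUd ?_ hUμ ?_ ?_).differentiableAt
  · rw [show 2 * μ - μ = μ by ring, hUμ]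
    ring
  · filter_upwards [lt_mem_nhds hμ, gt_mem_nhds (show μ < 2 * μ by linarith)] with ν hν hν'
    obtain ⟨g, hg, hVg⟩ := (hVstar ν hν.le).1
    obtain ⟨k, hk, hVk⟩ := (hVstar (2 * μ - ν) (by linarith)).1
    have hmid : Feasible ((1 / 2 : ℝ) • g + (1 / 2 : ℝ) • k) μ := by
      convert (hg.smul (r := 1 / 2) (by norm_num)).add (hk.smul (r := 1 / 2) (by norm_num)) using 1
      ring
    have h₁ := (hVstar μ hμ.le).2 ⟨_, hmid, rfl⟩
    have h₂ := socialCost_midpoint_le (path := path) hc_conv hg.1 hk.1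
    have h₃ := hVU (2 * μ - ν) (by linarith)
    linarith
  · filter_upwards [lt_mem_nhds hμ] with ν hν using hVU ν hν.le

end Flows

/-- under C¹, nonnegative, nondecreasing costs with `t·c_e(t)` convex and
`V*(μ) > 0` for all `μ > 0`, the price of anarchy `μ ↦ μ·λ(μ)/V*(μ)` is continuous on
`(0,∞)` and differentiable at every `μ > 0` at which `λ` is differentiable. -/
theorem PoA_continuous_and_differentiable
    [Fintype E] [DecidableEq E] [Nonempty E] [Fintype P] [Nonempty P]
    (path : P → Finset E) (hpath : ∀ p, (path p).Nonempty)
    (c : E → ℝ → ℝ)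
    (hc_C1 : ∀ e, ContDiff ℝ 1 (c e))
    (hc_nonneg : ∀ e x, 0 ≤ c e x)
    (hc_mono : ∀ e, Monotone (c e))
    (hc_conv : ∀ e, ConvexOn ℝ (Set.Ici 0) (fun t => t * c e t))
    (feq : ℝ → P → ℝ) (lamf : ℝ → ℝ)
    (hfeq : ∀ μ : ℝ, 0 < μ → IsWardrop path c μ (feq μ) (lamf μ))
    (Vstar : ℝ → ℝ)
    (hVstar : ∀ μ : ℝ, 0 ≤ μ →
      IsLeast {y | ∃ f, Feasible f μ ∧ y = socialCost path c f} (Vstar μ))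
    (hVpos : ∀ μ : ℝ, 0 < μ → 0 < Vstar μ) :
    ContinuousOn (fun μ => μ * lamf μ / Vstar μ) (Set.Ioi 0) ∧
    ∀ μ : ℝ, 0 < μ → DifferentiableAt ℝ lamf μ →
      DifferentiableAt ℝ (fun μ => μ * lamf μ / Vstar μ) μ := by
  have hV : ∀ μ : ℝ, 0 < μ → DifferentiableAt ℝ Vstar μ := fun μ hμ =>
    differentiableAt_optimalCost (fun e => (hc_C1 e).differentiable one_ne_zero) hc_conv hVstar hμ
  refine ⟨fun μ hμ => ContinuousAt.continuousWithinAt ?_, fun μ hμ hlam => ?_⟩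
  · exact (continuousAt_id.mul (continuousAt_equilibriumCost (fun e => (hc_C1 e).continuous)
      hc_mono hfeq hμ)).div (hV μ hμ).continuousAt (hVpos μ hμ).ne'
  · exact (differentiableAt_id.mul hlam).div (hV μ hμ) (hVpos μ hμ).ne'
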